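/- arXiv:1805.04610 — 6 statements merged into one kernel-verified Lean document; each statement's English description precedes it below -/
import Mathlib

section
/- For every p ∈ (0,1), the sequence T^ν(0)(p) converges to H(p) as ν → ∞, where 0 denotes the zero function, H(p) = −p·log₂ p − (1−p)·log₂(1−p) is the binary Shannon entropy, and T is the Peres rate operator. (This expresses the asymptotic optimality of the Peres function: the output rates r_ν = T^ν(0) of the depth-ν truncated Peres functions converge to the entropy bound.) -/
open Real

/-- Binary Shannon entropy H(p) = −p·log₂ p − (1−p)·log₂(1−p)
    (equal to 0 at p = 0 and p = 1 since `Real.logb 2 0 = 0`). -/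
noncomputable def binEnt (p : ℝ) : ℝ :=
  -(p * Real.logb 2 p) - (1 - p) * Real.logb 2 (1 - p)

/-- The Peres rate operator
    T(f)(p) = pq + ½·f(p²+q²) + ½·(p²+q²)·f(p²/(p²+q²)), q = 1 − p. -/
noncomputable def peresOp (f : ℝ → ℝ) : ℝ → ℝ := fun p =>
  p * (1 - p) + (1 / 2) * f (p ^ 2 + (1 - p) ^ 2)
    + (1 / 2) * (p ^ 2 + (1 - p) ^ 2) * f (p ^ 2 / (p ^ 2 + (1 - p) ^ 2))

lemma peres_aux_bound (p : ℝ) (h0 : 0 < p) (h1 : p < 1) :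
    0 ≤ -(p * Real.log p) ∧ -(p * Real.log p) ≤ 2 * √(p * (1 - p)) := by
  have hl := Real.log_neg h0 h1
  refine ⟨by nlinarith, ?_⟩
  have hs : 0 < √p := Real.sqrt_pos.2 h0
  have hsq : √p ^ 2 = p := Real.sq_sqrt h0.le
  have ht : 0 < √(1 - p) := Real.sqrt_pos.2 (by linarith)
  have htq : √(1 - p) ^ 2 = 1 - p := Real.sq_sqrt (by linarith)
  rw [Real.sqrt_mul h0.le]
  have e : Real.log p = 2 * Real.log (√p) := by
    rw [Real.log_sqrt h0.le]; ring
  have h2 := Real.one_sub_inv_le_log_of_pos hs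
  have h3 : √p * (1 - (√p)⁻¹) = √p - 1 := by field_simp
  have h4 := mul_le_mul_of_nonneg_left h2 hs.le
  rw [h3] at h4
  have h5 : √p < 1 := by nlinarith
  have h6 : √(1 - p) < 1 := by nlinarith
  have h7 : 1 - √p ≤ √(1 - p) := by nlinarith
  have h8 : p * Real.log p = 2 * √p * (√p * Real.log (√p)) := by
    rw [e]; linear_combination (-2 * Real.log (√p)) * hsq
  rw [h8]
  nlinarith

lemma peres_ent_bound (p : ℝ) (h0 : 0 < p) (h1 : p < 1) :
    |binEnt p| ≤ 4 / Real.log 2 * √(p * (1 - p)) := by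
  obtain ⟨a, b⟩ := peres_aux_bound p h0 h1
  obtain ⟨c, d⟩ := peres_aux_bound (1 - p) (by linarith) (by linarith)
  have hl : 0 < Real.log 2 := Real.log_pos (by norm_num)
  rw [show (1 - p) * (1 - (1 - p)) = p * (1 - p) by ring] at d
  have e : binEnt p = (-(p * Real.log p) + -((1 - p) * Real.log (1 - p))) / Real.log 2 := by
    unfold binEnt Real.logb; field_simp; ring
  rw [e, abs_of_nonneg (by positivity), div_mul_eq_mul_div]
  gcongr
  linarith

lemma peres_fixed (p : ℝ) (h0 : 0 < p) (h1 : p < 1) : peresOp binEnt p = binEnt p := by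
  have hq : 0 < 1 - p := by linarith
  have hs : 0 < p ^ 2 + (1 - p) ^ 2 := by positivity
  have hl : Real.log 2 ≠ 0 := (Real.log_pos (by norm_num)).ne'
  have e1 : 1 - (p ^ 2 + (1 - p) ^ 2) = 2 * (p * (1 - p)) := by ring
  have e2 : 1 - p ^ 2 / (p ^ 2 + (1 - p) ^ 2) = (1 - p) ^ 2 / (p ^ 2 + (1 - p) ^ 2) := by
    field_simp; ring
  unfold peresOp binEnt Real.logb
  rw [e2, e1, Real.log_mul two_ne_zero (by positivity), Real.log_mul h0.ne' hq.ne',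
    Real.log_div (by positivity) hs.ne', Real.log_div (by positivity) hs.ne',
    Real.log_pow, Real.log_pow]
  push_cast
  generalize Real.log (p ^ 2 + (1 - p) ^ 2) = S
  generalize Real.log (1 - p) = Q
  generalize Real.log p = P
  field_simp
  ring

lemma peres_contr (p : ℝ) (h0 : 0 < p) (h1 : p < 1) :
    1 / 2 * √((p ^ 2 + (1 - p) ^ 2) * (1 - (p ^ 2 + (1 - p) ^ 2)))
      + 1 / 2 * (p ^ 2 + (1 - p) ^ 2) * √(p ^ 2 / (p ^ 2 + (1 - p) ^ 2) *
        (1 - p ^ 2 / (p ^ 2 + (1 - p) ^ 2))) ≤ 4 / 5 * √(p * (1 - p)) := by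
  have hq : 0 < 1 - p := by linarith
  have hs : 0 < p ^ 2 + (1 - p) ^ 2 := by positivity
  have hx : 0 < p * (1 - p) := by positivity
  have e2 : p ^ 2 / (p ^ 2 + (1 - p) ^ 2) * (1 - p ^ 2 / (p ^ 2 + (1 - p) ^ 2))
      = (p * (1 - p) / (p ^ 2 + (1 - p) ^ 2)) ^ 2 := by
    field_simp; ring
  have e1 : (p ^ 2 + (1 - p) ^ 2) * (1 - (p ^ 2 + (1 - p) ^ 2))
      = (p * (1 - p)) * (2 * (p ^ 2 + (1 - p) ^ 2)) := by ring
  rw [e2, e1, Real.sqrt_sq (by positivity), Real.sqrt_mul hx.le]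
  have e3 : 1 / 2 * (p ^ 2 + (1 - p) ^ 2) * (p * (1 - p) / (p ^ 2 + (1 - p) ^ 2))
      = √(p * (1 - p)) * (1 / 2 * √(p * (1 - p))) := by
    have := Real.sq_sqrt hx.le
    field_simp; linarith
  rw [e3]
  have ha := Real.sqrt_nonneg (p * (1 - p))
  have haq := Real.sq_sqrt hx.le
  have hb := Real.sqrt_nonneg (2 * (p ^ 2 + (1 - p) ^ 2))
  have hbq := Real.sq_sqrt (show 0 ≤ 2 * (p ^ 2 + (1 - p) ^ 2) by positivity)
  have key : √(2 * (p ^ 2 + (1 - p) ^ 2)) + √(p * (1 - p)) ≤ 8 / 5 := by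
    refine abs_le_of_sq_le_sq' ?_ (by norm_num) |>.2
    nlinarith [sq_nonneg (√(2 * (p ^ 2 + (1 - p) ^ 2)) - 4 * √(p * (1 - p)))]
  nlinarith

lemma peres_err (ν : ℕ) : ∀ p : ℝ, 0 < p → p < 1 →
    |(peresOp^[ν] (fun _ => 0)) p - binEnt p| ≤ 4 / Real.log 2 * √(p * (1 - p)) * (4 / 5) ^ ν := by
  induction ν with
  | zero =>
    intro p h0 h1
    simpa using peres_ent_bound p h0 h1
  | succ n ih =>
    intro p h0 h1
    rw [Function.iterate_succ_apply', ← peres_fixed p h0 h1]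
    generalize peresOp^[n] (fun _ => 0) = f at *
    have hq : 0 < 1 - p := by linarith
    have hs : 0 < p ^ 2 + (1 - p) ^ 2 := by positivity
    have hl : 0 < Real.log 2 := Real.log_pos (by norm_num)
    have A := ih (p ^ 2 + (1 - p) ^ 2) hs (by nlinarith)
    have B := ih (p ^ 2 / (p ^ 2 + (1 - p) ^ 2)) (by positivity)
      (by rw [div_lt_one hs]; nlinarith)
    have C := mul_le_mul_of_nonneg_left (peres_contr p h0 h1)
      (show 0 ≤ 4 / Real.log 2 * (4 / 5) ^ n by positivity)
    have B' := mul_le_mul_of_nonneg_left B hs.le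
    unfold peresOp
    generalize 4 / Real.log 2 = K at *
    generalize p ^ 2 / (p ^ 2 + (1 - p) ^ 2) = t at *
    generalize p ^ 2 + (1 - p) ^ 2 = s at *
    rw [pow_succ]
    calc _ = |1 / 2 * (f s - binEnt s) + 1 / 2 * (s * (f t - binEnt t))| := by congr 1; ring
      _ ≤ |1 / 2 * (f s - binEnt s)| + |1 / 2 * (s * (f t - binEnt t))| := abs_add_le _ _
      _ = 1 / 2 * |f s - binEnt s| + 1 / 2 * (s * |f t - binEnt t|) := by
        rw [abs_mul, abs_mul, abs_mul, abs_of_pos hs, abs_of_pos (by norm_num : (0:ℝ) < 1 / 2)]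
      _ ≤ _ := by nlinarith

/-- The output rates of the truncated Peres functions converge to the entropy:
    T^ν(0)(p) → H(p) for every p ∈ (0,1). -/
theorem peres_rate_tendsto_entropy (p : ℝ) (hp : p ∈ Set.Ioo (0 : ℝ) 1) :
    Filter.Tendsto (fun ν : ℕ => (peresOp^[ν] (fun _ => 0)) p)
      Filter.atTop (nhds (binEnt p)) := by
  rw [tendsto_iff_norm_sub_tendsto_zero]
  refine squeeze_zero (fun _ => norm_nonneg _) (fun ν => peres_err ν p hp.1 hp.2) ?_
  simpa using (tendsto_pow_atTop_nhds_zero_of_lt_one (by norm_num : (0:ℝ) ≤ 4 / 5)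
    (by norm_num)).const_mul (4 / Real.log 2 * √(p * (1 - p)))
end

section
/- For every p ∈ (0,1), with q = 1 − p, the binary entropy satisfies H(p) = p·q + (1/2)·H(p² + q²) + (1/2)·(p² + q²)·H(p²/(p² + q²)). Equivalently, the binary entropy function H is a fixed point of the Peres rate operator T. -/
open Real

/-- The binary entropy is a fixed point of the Peres rate operator:
    H(p) = pq + ½H(p²+q²) + ½(p²+q²)·H(p²/(p²+q²)) for p ∈ (0,1). -/
theorem entropy_fixed_point (p : ℝ) (hp : p ∈ Set.Ioo (0 : ℝ) 1) :
    binEnt p = peresOp binEnt p := by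
  obtain ⟨h0, h1⟩ := hp
  have hq : 0 < 1 - p := by linarith
  have hs : 0 < p ^ 2 + (1 - p) ^ 2 := by positivity
  have e1 : 1 - (p ^ 2 + (1 - p) ^ 2) = 2 * (p * (1 - p)) := by ring
  have e2 : 1 - p ^ 2 / (p ^ 2 + (1 - p) ^ 2) = (1 - p) ^ 2 / (p ^ 2 + (1 - p) ^ 2) := by
    field_simp
    ring
  have l1 : Real.logb 2 (2 * (p * (1 - p))) = 1 + (Real.logb 2 p + Real.logb 2 (1 - p)) := by
    rw [Real.logb_mul (by norm_num) (by positivity), Real.logb_mul h0.ne' hq.ne',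
      Real.logb_self_eq_one (by norm_num)]
  have l2 : Real.logb 2 (p ^ 2 / (p ^ 2 + (1 - p) ^ 2))
      = 2 * Real.logb 2 p - Real.logb 2 (p ^ 2 + (1 - p) ^ 2) := by
    rw [Real.logb_div (by positivity) hs.ne', Real.logb_pow]
    norm_num
  have l3 : Real.logb 2 ((1 - p) ^ 2 / (p ^ 2 + (1 - p) ^ 2))
      = 2 * Real.logb 2 (1 - p) - Real.logb 2 (p ^ 2 + (1 - p) ^ 2) := by
    rw [Real.logb_div (by positivity) hs.ne', Real.logb_pow]
    norm_num
  unfold peresOp binEnt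
  simp only [e1, e2, l1, l2, l3]
  generalize Real.logb 2 (p ^ 2 + (1 - p) ^ 2) = S
  generalize Real.logb 2 p = A
  generalize Real.logb 2 (1 - p) = B
  field_simp
  ring
end

section
/- For every ν ≥ 0 and every p ∈ [0,1], T^ν(0)(p) ≤ H(p), i.e., the output rate of the depth-ν truncated Peres function is bounded above by the binary Shannon entropy. -/
open Real

theorem binEnt_nonneg_aux (p : ℝ) (hp : p ∈ Set.Icc (0 : ℝ) 1) : 0 ≤ binEnt p := by
  obtain ⟨h0, h1⟩ := hp
  have a : Real.logb 2 p ≤ 0 := Real.logb_nonpos (by norm_num) h0 h1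
  have b : Real.logb 2 (1 - p) ≤ 0 :=
    Real.logb_nonpos (by norm_num) (by linarith) (by linarith)
  unfold binEnt
  nlinarith [mul_nonneg h0 (neg_nonneg.2 a),
    mul_nonneg (sub_nonneg.2 h1) (neg_nonneg.2 b)]

theorem peresOp_binEnt_aux (p : ℝ) (hp : p ∈ Set.Icc (0 : ℝ) 1) :
    peresOp binEnt p = binEnt p := by
  obtain ⟨h0, h1⟩ := hp
  rcases h0.eq_or_lt with rfl | h0
  · simp [peresOp, binEnt]
  rcases h1.eq_or_lt with rfl | h1
  · simp [peresOp, binEnt]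
  have hq : 0 < 1 - p := by linarith
  have hs : 0 < p ^ 2 + (1 - p) ^ 2 := by positivity
  have e1 : 1 - (p ^ 2 + (1 - p) ^ 2) = 2 * (p * (1 - p)) := by ring
  have e2 : 1 - p ^ 2 / (p ^ 2 + (1 - p) ^ 2) = (1 - p) ^ 2 / (p ^ 2 + (1 - p) ^ 2) := by
    field_simp; ring
  simp only [peresOp, binEnt]
  rw [e1, e2, Real.logb_mul (by norm_num) (by positivity), Real.logb_mul h0.ne' hq.ne',
    Real.logb_div (by positivity) hs.ne', Real.logb_div (by positivity) hs.ne',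
    Real.logb_pow, Real.logb_pow, Real.logb_self_eq_one (by norm_num)]
  generalize Real.logb 2 p = a
  generalize Real.logb 2 (1 - p) = b
  generalize Real.logb 2 (p ^ 2 + (1 - p) ^ 2) = c
  field_simp
  push_cast
  ring

/-- The output rate of the depth-ν truncated Peres function is bounded by the
    binary Shannon entropy: T^ν(0)(p) ≤ H(p) for p ∈ [0,1]. -/
theorem peres_rate_le_entropy (ν : ℕ) (p : ℝ) (hp : p ∈ Set.Icc (0 : ℝ) 1) :
    (peresOp^[ν] (fun _ => 0)) p ≤ binEnt p := by
  induction ν generalizing p with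
  | zero => exact binEnt_nonneg_aux p hp
  | succ n ih =>
    rw [Function.iterate_succ_apply', ← peresOp_binEnt_aux p hp]
    obtain ⟨h0, h1⟩ := hp
    have hs : 0 < p ^ 2 + (1 - p) ^ 2 := by nlinarith [sq_nonneg (2 * p - 1)]
    have i1 := ih (p ^ 2 + (1 - p) ^ 2) ⟨hs.le, by nlinarith⟩
    have i2 := ih (p ^ 2 / (p ^ 2 + (1 - p) ^ 2))
      ⟨by positivity, by rw [div_le_one hs]; nlinarith [sq_nonneg (1 - p)]⟩
    simp only [peresOp]
    gcongr
end

section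
/- If A and B are extracting multisets of binary strings, then the multiset {a * b : a ∈ A, b ∈ B} of all pairwise concatenations (counted with multiplicity, i.e., the multiset image of the multiset product A × B under concatenation) is extracting. -/
/-- A multiset of binary strings is extracting: every string of the same
length as a member occurs with the same multiplicity as that member. -/
def ExtractingMultiset (A : Multiset (List Bool)) : Prop :=
  ∀ z ∈ A, ∀ z' : List Bool, z'.length = z.length → A.count z' = A.count z

theorem count_map_append_aux (a w : List Bool) (B : Multiset (List Bool)) :
    (B.map fun b => a ++ b).count w =
      ∑ k ∈ Finset.range (w.length + 1),
        (if w.take k = a then B.count (w.drop k) else 0) := by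
  by_cases h : a <+: w
  · obtain ⟨b, rfl⟩ := h
    rw [Multiset.count_map_eq_count' (fun b => a ++ b) B (List.append_right_injective a) b]
    rw [Finset.sum_eq_single a.length]
    · simp
    · intro k hk hne
      rw [if_neg]
      intro h
      have := congrArg List.length h
      simp only [List.length_take, Finset.mem_range] at this hk
      simp only [List.length_append] at this hk
      omega
    · intro h
      simp at h
  · rw [Multiset.count_eq_zero_of_notMem, Finset.sum_eq_zero]
    · intro k _
      rw [if_neg]
      rintro rfl
      exact h (List.take_prefix k w)
    · intro hm
      obtain ⟨b, _, rfl⟩ := Multiset.mem_map.1 hm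
      exact h (List.prefix_append a b)

theorem count_concat_aux (A B : Multiset (List Bool)) (w : List Bool) :
    ((A ×ˢ B).map fun p => p.1 ++ p.2).count w =
      ∑ k ∈ Finset.range (w.length + 1), A.count (w.take k) * B.count (w.drop k) := by
  induction A using Multiset.induction_on with
  | empty => simp
  | cons a A ih =>
    rw [Multiset.cons_product, Multiset.map_add, Multiset.count_add, ih, Multiset.map_map]
    have := count_map_append_aux a w B
    simp only [Function.comp_def]
    rw [this, ← Finset.sum_add_distrib]
    refine Finset.sum_congr rfl fun k _ => ?_
    rw [Multiset.count_cons]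
    split_ifs <;> ring

theorem ExtractingMultiset.count_eq_aux {A : Multiset (List Bool)} (hA : ExtractingMultiset A)
    (z z' : List Bool) (h : z'.length = z.length) : A.count z' = A.count z := by
  by_cases hz : z ∈ A
  · exact hA z hz z' h
  by_cases hz' : z' ∈ A
  · exact (hA z' hz' z h.symm).symm
  · rw [Multiset.count_eq_zero_of_notMem hz, Multiset.count_eq_zero_of_notMem hz']

/-- Pairwise concatenation of extracting multisets is extracting. -/
theorem extracting_multiset_concat (A B : Multiset (List Bool))
    (hA : ExtractingMultiset A) (hB : ExtractingMultiset B) :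
    ExtractingMultiset ((A ×ˢ B).map fun p => p.1 ++ p.2) := by
  intro z _ z' h
  rw [count_concat_aux, count_concat_aux, h]
  refine Finset.sum_congr rfl fun k _ => ?_
  rw [hA.count_eq_aux (z.take k) (z'.take k) (by simp [h]),
    hB.count_eq_aux (z.drop k) (z'.drop k) (by simp [h])]
end

section
/- The extended von Neumann function Ψ₁ on {0,1}^{2n} is extracting: for every n, every p ∈ [0,1], and every pair of binary strings z₁, z₂ of equal length, the sum of p^{#0(x)}·(1−p)^{#1(x)} over all x ∈ {0,1}^{2n} with Ψ₁(x) = z₁ equals the corresponding sum over x with Ψ₁(x) = z₂. -/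
/-- Split a binary string into consecutive non-overlapping pairs. -/
def pairList : List Bool → List (Bool × Bool)
  | a :: b :: rest => (a, b) :: pairList rest
  | _ => []

/-- The von Neumann map: Ψ₁(00) = Ψ₁(11) = λ, Ψ₁(01) = 0, Ψ₁(10) = 1,
    applied to consecutive non-overlapping pairs. -/
def vnExt (x : List Bool) : List Bool :=
  (pairList x).filterMap fun p => if p.1 = p.2 then none else some p.1

/-- Probability weight of a binary string under a Bernoulli(p for 0) source. -/
noncomputable def wt (p : ℝ) (x : List Bool) : ℝ :=
  p ^ (x.count false) * (1 - p) ^ (x.count true)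

theorem sum_ofFn_succ (m : ℕ) (g : List Bool → ℝ) :
    (∑ x : Fin (m + 1) → Bool, g (List.ofFn x)) =
      (∑ y : Fin m → Bool, g (true :: List.ofFn y)) +
      ∑ y : Fin m → Bool, g (false :: List.ofFn y) := by
  rw [← (Fin.consEquiv (fun _ : Fin (m + 1) => Bool)).sum_comp, Fintype.sum_prod_type]
  simp [Fin.consEquiv, List.ofFn_succ]

theorem vnSum_succ (n : ℕ) (p : ℝ) (z : List Bool) :
    (∑ x : Fin (2 * (n + 1)) → Bool,
        if vnExt (List.ofFn x) = z then wt p (List.ofFn x) else 0) =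
    (p ^ 2 + (1 - p) ^ 2) * (∑ x : Fin (2 * n) → Bool,
        if vnExt (List.ofFn x) = z then wt p (List.ofFn x) else 0) +
    p * (1 - p) * (∑ x : Fin (2 * n) → Bool,
        if true :: vnExt (List.ofFn x) = z then wt p (List.ofFn x) else 0) +
    p * (1 - p) * (∑ x : Fin (2 * n) → Bool,
        if false :: vnExt (List.ofFn x) = z then wt p (List.ofFn x) else 0) := by
  have e1 := sum_ofFn_succ (2 * n + 1) (fun l => if vnExt l = z then wt p l else 0)
  have e2 := sum_ofFn_succ (2 * n) (fun l => if vnExt (true :: l) = z then wt p (true :: l) else 0)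
  have e3 := sum_ofFn_succ (2 * n) (fun l => if vnExt (false :: l) = z then wt p (false :: l) else 0)
  refine e1.trans ?_
  rw [e2, e3]
  simp only [Finset.mul_sum, ← Finset.sum_add_distrib]
  refine Finset.sum_congr rfl fun x _ => ?_
  have h1 (l : List Bool) : vnExt (true :: true :: l) = vnExt l := by simp [vnExt, pairList]
  have h2 (l : List Bool) : vnExt (true :: false :: l) = true :: vnExt l := by
    simp [vnExt, pairList]
  have h3 (l : List Bool) : vnExt (false :: true :: l) = false :: vnExt l := by
    simp [vnExt, pairList]
  have h4 (l : List Bool) : vnExt (false :: false :: l) = vnExt l := by simp [vnExt, pairList]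
  have w1 (l : List Bool) : wt p (true :: l) = (1 - p) * wt p l := by
    simp [wt, pow_succ]; ring
  have w2 (l : List Bool) : wt p (false :: l) = p * wt p l := by
    simp [wt, pow_succ]; ring
  simp only [h1, h2, h3, h4, w1, w2]
  split_ifs <;> ring

/-- The extended von Neumann function Ψ₁ on {0,1}^{2n} is extracting. -/
theorem vonNeumann_extracting (n : ℕ) (p : ℝ) (hp : p ∈ Set.Icc (0 : ℝ) 1)
    (z₁ z₂ : List Bool) (hz : z₁.length = z₂.length) :
    (∑ x : Fin (2 * n) → Bool,
        if vnExt (List.ofFn x) = z₁ then wt p (List.ofFn x) else 0) =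
    (∑ x : Fin (2 * n) → Bool,
        if vnExt (List.ofFn x) = z₂ then wt p (List.ofFn x) else 0) := by
  induction n generalizing z₁ z₂ with
  | zero =>
    cases z₁ <;> cases z₂ <;> simp_all [vnExt, pairList]
  | succ n ih =>
    rw [vnSum_succ, vnSum_succ, ih z₁ z₂ hz]
    cases z₁ with
    | nil =>
      cases z₂ with
      | nil => rfl
      | cons b t => simp at hz
    | cons a s =>
      cases z₂ with
      | nil => simp at hz
      | cons b t =>
        have h := ih s t (by simpa using hz)
        cases a <;> cases b <;> simp [h]
end

section
/- Entropy decomposition for the 3-face Peres binarization tree: for p, q, r > 0 with p + q + r = 1, setting s = 2(pq + pr + qr), the ternary Shannon entropy H(p,q,r) = −p·log₂ p − q·log₂ q − r·log₂ r satisfies 2·H(p,q,r) = H₂(s) + (1−s)·H(p²/(1−s), q²/(1−s), r²/(1−s)) + s + s·H(2qr/s, 2pq/s, 2pr/s), where H₂(s) = −s·log₂ s − (1−s)·log₂(1−s). -/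
/-- Ternary Shannon entropy H(p,q,r) = −p·log₂p − q·log₂q − r·log₂r. -/
noncomputable def ent3 (p q r : ℝ) : ℝ :=
  -(p * Real.logb 2 p) - q * Real.logb 2 q - r * Real.logb 2 r

/-- Binary Shannon entropy. -/
noncomputable def ent2 (s : ℝ) : ℝ :=
  -(s * Real.logb 2 s) - (1 - s) * Real.logb 2 (1 - s)

theorem ent3_scale (a b c t : ℝ) (ha : 0 < a) (hb : 0 < b) (hc : 0 < c) (ht : a + b + c = t) :
    t * ent3 (a / t) (b / t) (c / t) =
      t * Real.logb 2 t - a * Real.logb 2 a - b * Real.logb 2 b - c * Real.logb 2 c := by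
  have h0 : t ≠ 0 := by
    have : 0 < t := by linarith
    exact this.ne'
  unfold ent3
  rw [Real.logb_div ha.ne' h0, Real.logb_div hb.ne' h0, Real.logb_div hc.ne' h0]
  field_simp
  rw [← ht]
  ring

/-- Entropy decomposition for the 3-face Peres binarization tree. -/
theorem entropy_decomposition_three_face (p q r : ℝ)
    (hp : 0 < p) (hq : 0 < q) (hr : 0 < r) (hsum : p + q + r = 1) :
    2 * ent3 p q r =
      ent2 (2 * (p * q + p * r + q * r))
        + (1 - 2 * (p * q + p * r + q * r)) *
            ent3 (p ^ 2 / (1 - 2 * (p * q + p * r + q * r)))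
                 (q ^ 2 / (1 - 2 * (p * q + p * r + q * r)))
                 (r ^ 2 / (1 - 2 * (p * q + p * r + q * r)))
        + 2 * (p * q + p * r + q * r)
        + 2 * (p * q + p * r + q * r) *
            ent3 (2 * q * r / (2 * (p * q + p * r + q * r)))
                 (2 * p * q / (2 * (p * q + p * r + q * r)))
                 (2 * p * r / (2 * (p * q + p * r + q * r))) := by
  have h2 : Real.logb 2 (2 : ℝ) = 1 := Real.logb_self_eq_one (by norm_num)
  have hm : ∀ x y : ℝ, 0 < x → 0 < y →
      Real.logb 2 (2 * x * y) = 1 + Real.logb 2 x + Real.logb 2 y := by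
    intro x y hx hy
    rw [Real.logb_mul (by positivity) hy.ne', Real.logb_mul (by norm_num) hx.ne', h2]
  have hs : ∀ x : ℝ, Real.logb 2 (x ^ 2) = 2 * Real.logb 2 x := by
    intro x
    rw [Real.logb_pow]
    norm_num
  have hr' : r = 1 - p - q := by linarith
  rw [ent3_scale (p ^ 2) (q ^ 2) (r ^ 2) _ (by positivity) (by positivity) (by positivity)
      (by rw [hr']; ring),
    ent3_scale (2 * q * r) (2 * p * q) (2 * p * r) _ (by positivity) (by positivity)
      (by positivity) (by ring),
    hm q r hq hr, hm p q hp hq, hm p r hp hr, hs, hs, hs]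
  unfold ent2 ent3
  linear_combination (2 * p * Real.logb 2 p + 2 * q * Real.logb 2 q + 2 * r * Real.logb 2 r) * hsum
end
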